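/- Let a < b be real and I = [a,b]. If f, g : ℝ → ℝ are Lebesgue-measurable, positive on I, integrable on I with ∫_I f = ∫_I g = 1, with ln ∘ f and ln ∘ g integrable on I, and clr[f](x) = clr[g](x) for all x ∈ I, then f(x) = g(x) for all x ∈ I. That is, the clr transformation is a one-to-one mapping on unit-integral densities on I. -/

import Mathlib

open MeasureTheory

/-- The centred logratio (clr) transformation of a function `f` on the interval `[a,b]`. -/
noncomputable def clr (a b : ℝ) (f : ℝ → ℝ) : ℝ → ℝ :=
  fun x => Real.log (f x) - (1 / (b - a)) * ∫ t in Set.Icc a b, Real.log (f t)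

/-- The clr transformation is one-to-one on unit-integral densities on `[a,b]`:
if two such densities have the same clr transform on `[a,b]`, they agree on `[a,b]`. -/
theorem clr_injective (a b : ℝ) (hab : a < b) (f g : ℝ → ℝ)
    (hfmeas : Measurable f) (hgmeas : Measurable g)
    (hfpos : ∀ x ∈ Set.Icc a b, 0 < f x) (hgpos : ∀ x ∈ Set.Icc a b, 0 < g x)
    (hfint : IntegrableOn f (Set.Icc a b)) (hgint : IntegrableOn g (Set.Icc a b))
    (hfone : (∫ x in Set.Icc a b, f x) = 1) (hgone : (∫ x in Set.Icc a b, g x) = 1)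
    (hflog : IntegrableOn (fun x => Real.log (f x)) (Set.Icc a b))
    (hglog : IntegrableOn (fun x => Real.log (g x)) (Set.Icc a b))
    (hclr : ∀ x ∈ Set.Icc a b, clr a b f x = clr a b g x) :
    ∀ x ∈ Set.Icc a b, f x = g x := by
  obtain ⟨c, hc⟩ : ∃ c : ℝ, c = (1 / (b - a)) * (∫ t in Set.Icc a b, Real.log (f t)) -
      (1 / (b - a)) * ∫ t in Set.Icc a b, Real.log (g t) := ⟨_, rfl⟩
  have key : ∀ x ∈ Set.Icc a b, f x = Real.exp c * g x := by
    intro x hx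
    have h := hclr x hx
    simp only [clr] at h
    have h2 : Real.log (f x) = c + Real.log (g x) := by linarith
    rw [← Real.exp_log (hfpos x hx), h2, Real.exp_add, Real.exp_log (hgpos x hx)]
  have h1 : (∫ x in Set.Icc a b, f x) = ∫ x in Set.Icc a b, Real.exp c * g x :=
    setIntegral_congr_fun measurableSet_Icc key
  rw [integral_const_mul, hfone, hgone, mul_one] at h1
  intro x hx
  rw [key x hx, ← h1, one_mul]
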